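/- S-equivalence is an equivalence relation on the set of pseudo-isotopies of V = Circle × S³ starting at the identity (it is reflexive, symmetric, and transitive). (Second assertion of Proposition 4.2 of the paper.) -/

import Mathlib

open scoped Manifold
open Metric Set Module

noncomputable section

/-- The 3-sphere: unit sphere in `EuclideanSpace ℝ (Fin 4)`. -/
abbrev S3 : Type := Metric.sphere (0 : EuclideanSpace ℝ (Fin 4)) 1

/-- The 4-sphere: unit sphere in `EuclideanSpace ℝ (Fin 5)`. -/
abbrev S4 : Type := Metric.sphere (0 : EuclideanSpace ℝ (Fin 5)) 1

instance : Fact (Module.finrank ℝ (EuclideanSpace ℝ (Fin 4)) = 3 + 1) :=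
  ⟨finrank_euclideanSpace_fin⟩
instance : Fact (Module.finrank ℝ (EuclideanSpace ℝ (Fin 5)) = 4 + 1) :=
  ⟨finrank_euclideanSpace_fin⟩

/-- A `C^∞` diffeomorphism between two smooth manifolds, as a predicate on maps. -/
def IsDiffeoB {E H M E' H' M' : Type*} [NormedAddCommGroup E] [NormedSpace ℝ E]
    [TopologicalSpace H] [NormedAddCommGroup E'] [NormedSpace ℝ E'] [TopologicalSpace H']
    (I : ModelWithCorners ℝ E H) (I' : ModelWithCorners ℝ E' H')
    [TopologicalSpace M] [ChartedSpace H M] [TopologicalSpace M'] [ChartedSpace H' M']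
    (f : M → M') : Prop :=
  ContMDiff I I' (⊤ : ℕ∞) f ∧ ∃ g : M' → M, ContMDiff I' I (⊤ : ℕ∞) g ∧
    Function.LeftInverse g f ∧ Function.RightInverse g f

/-- A smooth ambient isotopy of a manifold `M`: a family `F : ℝ → M → M` with `F 0 = id`,
each `F t` a bijection, and both `(t, x) ↦ F t x` and the family of inverses jointly `C^∞`. -/
def IsAmbientIsotopy {E H M : Type*} [NormedAddCommGroup E] [NormedSpace ℝ E]
    [TopologicalSpace H] (I : ModelWithCorners ℝ E H)
    [TopologicalSpace M] [ChartedSpace H M]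
    (F : ℝ → M → M) : Prop :=
  F 0 = id ∧ (∀ t, Function.Bijective (F t)) ∧
  ContMDiff (𝓘(ℝ, ℝ).prod I) I (⊤ : ℕ∞) (fun q : ℝ × M => F q.1 q.2) ∧
  ∃ G : ℝ → M → M, (∀ t, Function.LeftInverse (G t) (F t) ∧ Function.RightInverse (G t) (F t)) ∧
    ContMDiff (𝓘(ℝ, ℝ).prod I) I (⊤ : ℕ∞) (fun q : ℝ × M => G q.1 q.2)

/-- Two subsets of a smooth manifold are smoothly ambiently isotopic. -/
def AmbIsotopic {E H M : Type*} [NormedAddCommGroup E] [NormedSpace ℝ E]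
    [TopologicalSpace H] (I : ModelWithCorners ℝ E H)
    [TopologicalSpace M] [ChartedSpace H M]
    (A B : Set M) : Prop :=
  ∃ F : ℝ → M → M, IsAmbientIsotopy I F ∧ (F 1) '' A = B

/-- A smooth embedding of the 3-sphere into a smooth manifold: `C^∞`, injective, a topological
embedding, and an immersion. -/
def IsS3Embedding {E H M : Type*} [NormedAddCommGroup E] [NormedSpace ℝ E]
    [TopologicalSpace H] (I : ModelWithCorners ℝ E H)
    [TopologicalSpace M] [ChartedSpace H M]
    (f : S3 → M) : Prop :=
  ContMDiff (𝓡 3) I (⊤ : ℕ∞) f ∧ Function.Injective f ∧ Topology.IsEmbedding f ∧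
    ∀ x : S3, Function.Injective (mfderiv (𝓡 3) I f x)

/-- The 4-manifold `V = S¹ × S³`. -/
abbrev V : Type := Circle × S3

/-- The model for `V`. -/
abbrev IV := (𝓡 1).prod (𝓡 3)

/-- The model for `ℝ × S³`. -/
abbrev IRS := 𝓘(ℝ, ℝ).prod (𝓡 3)

/-- The universal covering `ℝ × S³ → V`, `(t, w) ↦ (exp t, w)`. -/
def pcov : ℝ × S3 → V := fun q => (Circle.exp q.1, q.2)

/-- The `n`-fold covering `V → V`, `(z, w) ↦ (zⁿ, w)`. -/
def pcovN (n : ℕ) : V → V := fun q => (q.1 ^ n, q.2)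

/-- Membership in `Diff₀(V)`: a diffeomorphism of `V` homotopic to the identity. -/
def InDiff0 (φ : V → V) : Prop :=
  IsDiffeoB IV IV φ ∧ ∃ hc : Continuous φ,
    ContinuousMap.Homotopic ⟨φ, hc⟩ (ContinuousMap.id V)

/-- A lift of `φ : V → V` to the `n`-fold cover. -/
def IsLiftN (n : ℕ) (φ φh : V → V) : Prop :=
  IsDiffeoB IV IV φh ∧ ∀ q : V, pcovN n (φh q) = φ (pcovN n q)

/-- A lift of `φ : V → V` to the universal cover `ℝ × S³`. -/
def IsLiftU (φ : V → V) (φt : ℝ × S3 → ℝ × S3) : Prop :=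
  IsDiffeoB IRS IRS φt ∧ ∀ q : ℝ × S3, pcov (φt q) = φ (pcov q)

/-- S-equivalence of elements of `Diff₀(V)`. -/
def SEquiv (φ ψ : V → V) : Prop :=
  ∃ n : ℕ, 1 ≤ n ∧ ∃ φh ψh : V → V, IsLiftN n φ φh ∧ IsLiftN n ψ ψh ∧
    ∃ z₀ : Circle,
      AmbIsotopic IV (φh '' (({z₀} : Set Circle) ×ˢ (Set.univ : Set S3)))
        (ψh '' (({z₀} : Set Circle) ×ˢ (Set.univ : Set S3)))

/-- `φ` interpolates to `ψ`: some lift of `φ` can be glued to some lift of `ψ` by a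
diffeomorphism of `ℝ × S³` agreeing with the first near `-∞` and the second near `+∞`. -/
def Interpolates (φ ψ : V → V) : Prop :=
  ∃ φt ψt h : ℝ × S3 → ℝ × S3, IsLiftU φ φt ∧ IsLiftU ψ ψt ∧
    IsDiffeoB IRS IRS h ∧ ∃ a b : ℝ, a ≤ b ∧
      (∀ q : ℝ × S3, q.1 ≤ a → h q = φt q) ∧
      (∀ q : ℝ × S3, b ≤ q.1 → h q = ψt q)

/-- The unit interval `I = [0, 1]` as a smooth manifold with boundary. -/
abbrev II : Type := Set.Icc (0 : ℝ) 1

def i0 : II := ⟨0, by norm_num⟩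
def i1 : II := ⟨1, by norm_num⟩

/-- The model for `V × I`. -/
abbrev IVI := IV.prod (𝓡∂ 1)

/-- The model for `(ℝ × S³) × I`. -/
abbrev IRSI := IRS.prod (𝓡∂ 1)

/-- A pseudo-isotopy of `V` from `φ₀` to `φ₁`. -/
def IsPseudoIsotopy (φ₀ φ₁ : V → V) (F : V × II → V × II) : Prop :=
  IsDiffeoB IVI IVI F ∧ (∀ x : V, F (x, i0) = (φ₀ x, i0)) ∧
    (∀ x : V, F (x, i1) = (φ₁ x, i1))

/-- A pseudo-isotopy of `V` starting at the identity. -/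
def IsPseudoIsotopyFromId (F : V × II → V × II) : Prop :=
  IsDiffeoB IVI IVI F ∧ ∀ x : V, F (x, i0) = (x, i0)

/-- The covering `(ℝ × S³) × I → V × I`. -/
def pI : (ℝ × S3) × II → V × II := fun q => (pcov q.1, q.2)

/-- A lift of a pseudo-isotopy of `V` starting at the identity. -/
def IsPLift (F : V × II → V × II) (Ft : (ℝ × S3) × II → (ℝ × S3) × II) : Prop :=
  IsDiffeoB IRSI IRSI Ft ∧ (∀ q, pI (Ft q) = F (pI q)) ∧
    ∀ y : ℝ × S3, Ft (y, i0) = (y, i0)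

/-- S-equivalence of pseudo-isotopies of `V` starting at the identity. -/
def PSEquiv (F₀ F₁ : V × II → V × II) : Prop :=
  ∃ Ft₀ Ft₁ H : (ℝ × S3) × II → (ℝ × S3) × II,
    IsPLift F₀ Ft₀ ∧ IsPLift F₁ Ft₁ ∧ IsDiffeoB IRSI IRSI H ∧
    ∃ a b : ℝ, a ≤ b ∧
      (∀ q : (ℝ × S3) × II, q.1.1 ≤ a → H q = Ft₀ q) ∧
      (∀ q : (ℝ × S3) × II, b ≤ q.1.1 → H q = Ft₁ q)

/-- A continuous real-valued function is smooth as soon as its composition with the covering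
`Circle.exp` is. -/
theorem contMDiff_of_circleExp_comp {E H M : Type*} [NormedAddCommGroup E] [NormedSpace ℝ E]
    [TopologicalSpace H] {I : ModelWithCorners ℝ E H} [TopologicalSpace M] [ChartedSpace H M]
    {n : WithTop ℕ∞} {θ : M → ℝ} (hθ : Continuous θ)
    (h : ContMDiff I (𝓡 1) n (fun x => Circle.exp (θ x))) : ContMDiff I 𝓘(ℝ, ℝ) n θ := by
  intro x₀
  have hg : ContMDiff I 𝓘(ℝ, ℂ) n (fun x => (Circle.exp (θ x) : ℂ)) :=
    haveI : Fact (finrank ℝ ℂ = 1 + 1) := Complex.finrank_real_complex_fact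
    (contMDiff_coe_sphere (E := ℂ) (n := 1)).comp h
  have hL : ContDiffAt ℝ n (fun z : ℂ =>
      θ x₀ + (Complex.log (z * (Circle.exp (-θ x₀) : ℂ))).im) (Circle.exp (θ x₀) : ℂ) := by
    have hmem : (Circle.exp (θ x₀) : ℂ) * (Circle.exp (-θ x₀) : ℂ) ∈ Complex.slitPlane := by
      rw [← Circle.coe_mul, ← Circle.exp_add]
      simp
    have hlog : ContDiffAt ℝ n (fun z : ℂ =>
        Complex.log (z * (Circle.exp (-θ x₀) : ℂ))) (Circle.exp (θ x₀) : ℂ) :=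
      ContDiffAt.comp (Circle.exp (θ x₀) : ℂ) ((Complex.contDiffAt_log hmem).restrict_scalars ℝ)
        (contDiffAt_id.mul contDiffAt_const)
    exact contDiffAt_const.add (Complex.imCLM.contDiff.contDiffAt.comp _ hlog)
  refine (hL.contMDiffAt.comp x₀ (hg x₀)).congr_of_eventuallyEq ?_
  filter_upwards [hθ.continuousAt.eventually (Metric.ball_mem_nhds (θ x₀) Real.pi_pos)] with x hx
  rw [Real.dist_eq, abs_lt] at hx
  rw [Function.comp_apply, ← Circle.coe_mul, ← Circle.exp_add, Complex.log_im,
    Circle.arg_exp (by linarith [hx.1]) (by linarith [hx.2])]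
  ring

theorem continuous_pI : Continuous pI := by
  unfold pI pcov
  fun_prop

theorem contMDiff_pI : ContMDiff IRSI IVI (⊤ : ℕ∞) pI :=
  ContMDiff.prodMk
    (ContMDiff.prodMk (contMDiff_circleExp.comp (contMDiff_fst.comp contMDiff_fst))
      (contMDiff_snd.comp contMDiff_fst)) contMDiff_snd

/-- Continuous maps into the cover with the same projection and the same values at the bottom
are equal. -/
theorem eq_of_pI_comp_eq {f g : (ℝ × S3) × II → (ℝ × S3) × II} (hf : Continuous f)
    (hg : Continuous g) (h : ∀ q, pI (f q) = pI (g q)) (h₀ : ∀ y, f (y, i0) = g (y, i0)) :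
    f = g := by
  funext ⟨y, s⟩
  have ht : (fun s : II => (f (y, s)).1.1) = fun s => (g (y, s)).1.1 :=
    Circle.isCoveringMap_exp.eq_of_comp_eq (by fun_prop) (by fun_prop)
      (funext fun s => congrArg (fun v : V × II => v.1.1) (h (y, s))) i0
      (congrArg (fun q : (ℝ × S3) × II => q.1.1) (h₀ y))
  exact Prod.ext (Prod.ext (congrFun ht s) (congrArg (fun v : V × II => v.1.2) (h (y, s))))
    (congrArg (fun v : V × II => v.2) (h (y, s)))

/-- A smooth self-map of `V × I` that is the identity at the bottom lifts to a smooth self-map of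
`(ℝ × S³) × I` that is the identity at the bottom. -/
theorem exists_contMDiff_lift {F : V × II → V × II} (hF : ContMDiff IVI IVI (⊤ : ℕ∞) F)
    (h₀ : ∀ x : V, F (x, i0) = (x, i0)) :
    ∃ Ft : (ℝ × S3) × II → (ℝ × S3) × II, ContMDiff IRSI IRSI (⊤ : ℕ∞) Ft ∧
      (∀ q, pI (Ft q) = F (pI q)) ∧ ∀ y : ℝ × S3, Ft (y, i0) = (y, i0) := by
  have hFp := hF.comp contMDiff_pI
  have hc : Continuous (fun r : unitInterval × (ℝ × S3) => (F (pI (r.2, r.1))).1.1) :=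
    continuous_fst.comp (continuous_fst.comp (hFp.continuous.comp continuous_swap))
  have hstart : ∀ y : ℝ × S3, (F (pI (y, i0))).1.1 = Circle.exp y.1 := fun y => by
    change (F (pcov y, i0)).1.1 = _
    rw [h₀]
    rfl
  let Θ := Circle.isCoveringMap_exp.liftHomotopy ⟨_, hc⟩ ⟨Prod.fst, continuous_fst⟩ hstart
  let θ : (ℝ × S3) × II → ℝ := fun q => Θ (q.2, q.1)
  have hθc : Continuous θ := Θ.continuous.comp continuous_swap
  have hθexp : ∀ q, Circle.exp (θ q) = (F (pI q)).1.1 := fun q =>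
    congrFun (Circle.isCoveringMap_exp.liftHomotopy_lifts ⟨_, hc⟩ ⟨Prod.fst, continuous_fst⟩
      hstart) (q.2, q.1)
  have hθ₀ : ∀ y, θ (y, i0) = y.1 :=
    Circle.isCoveringMap_exp.liftHomotopy_zero ⟨_, hc⟩ ⟨Prod.fst, continuous_fst⟩ hstart
  have hθ : ContMDiff IRSI 𝓘(ℝ, ℝ) (⊤ : ℕ∞) θ := by
    refine contMDiff_of_circleExp_comp hθc ?_
    simp_rw [hθexp]
    exact contMDiff_fst.comp (contMDiff_fst.comp hFp)
  refine ⟨fun q => ((θ q, (F (pI q)).1.2), (F (pI q)).2), ?_, fun q => ?_, fun y => ?_⟩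
  · exact (hθ.prodMk (contMDiff_snd.comp (contMDiff_fst.comp hFp))).prodMk
      (contMDiff_snd.comp hFp)
  · exact Prod.ext (Prod.ext (hθexp q) rfl) rfl
  · have h : F (pI (y, i0)) = (pcov y, i0) := h₀ _
    simp only [hθ₀, h]
    rfl

theorem IsPseudoIsotopyFromId.exists_isPLift {F : V × II → V × II}
    (hF : IsPseudoIsotopyFromId F) : ∃ Ft, IsPLift F Ft := by
  obtain ⟨⟨hs, G, hG, hGF, hFG⟩, h₀⟩ := hF
  obtain ⟨Ft, hFt, hFp, hF₀⟩ := exists_contMDiff_lift hs h₀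
  obtain ⟨Gt, hGt, hGp, hG₀⟩ := exists_contMDiff_lift hG fun x => by
    simpa [h₀] using hGF (x, i0)
  refine ⟨Ft, ⟨hFt, Gt, hGt, congrFun ?_, congrFun ?_⟩, hFp, hF₀⟩
  · exact eq_of_pI_comp_eq (hGt.continuous.comp hFt.continuous) continuous_id
      (fun q => by simp [hGp, hFp, hGF (pI q)]) (fun y => by simp [hF₀, hG₀])
  · exact eq_of_pI_comp_eq (hFt.continuous.comp hGt.continuous) continuous_id
      (fun q => by simp [hGp, hFp, hFG (pI q)]) (fun y => by simp [hF₀, hG₀])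

theorem IsPLift.unique {F : V × II → V × II} {f g : (ℝ × S3) × II → (ℝ × S3) × II}
    (hf : IsPLift F f) (hg : IsPLift F g) : f = g :=
  eq_of_pI_comp_eq hf.1.1.continuous hg.1.1.continuous (fun q => by rw [hf.2.1, hg.2.1])
    fun y => by rw [hf.2.2, hg.2.2]

/-- A lift of a pseudo-isotopy commutes with the deck transformation. -/
theorem IsPLift.apply_add_two_pi {F : V × II → V × II} {f : (ℝ × S3) × II → (ℝ × S3) × II}
    (hf : IsPLift F f) (t : ℝ) (w : S3) (s : II) :
    f ((t + 2 * Real.pi, w), s) =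
      (((f ((t, w), s)).1.1 + 2 * Real.pi, (f ((t, w), s)).1.2), (f ((t, w), s)).2) := by
  let τ : (ℝ × S3) × II → (ℝ × S3) × II := fun q => ((q.1.1 + 2 * Real.pi, q.1.2), q.2)
  have hτ : Continuous τ := by fun_prop
  have hp : ∀ q, pI (τ q) = pI q := fun q => by simp [pI, pcov, τ]
  refine congrFun (eq_of_pI_comp_eq (f := f ∘ τ) (g := τ ∘ f) (hf.1.1.continuous.comp hτ)
    (hτ.comp hf.1.1.continuous) (fun q => ?_) fun y => ?_) ((t, w), s)
  · simp [hf.2.1, hp]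
  · simp [hf.2.2, τ]

/-- A lift of a pseudo-isotopy moves the `ℝ`-coordinate by a bounded amount. -/
theorem IsPLift.exists_abs_sub_le {F : V × II → V × II} {f : (ℝ × S3) × II → (ℝ × S3) × II}
    (hf : IsPLift F f) : ∃ C : ℝ, ∀ q, |(f q).1.1 - q.1.1| ≤ C := by
  have hc : Continuous fun q : (ℝ × S3) × II => (f q).1.1 - q.1.1 := by
    have := hf.1.1.continuous
    fun_prop
  obtain ⟨C, hC⟩ := ((isCompact_Icc (a := (0 : ℝ)) (b := 2 * Real.pi)).prod
    (isCompact_univ (X := S3))).prod (isCompact_univ (X := II)) |>.exists_bound_of_continuousOn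
    hc.continuousOn
  refine ⟨C, fun ⟨⟨t, w⟩, s⟩ => ?_⟩
  have hper : Function.Periodic (fun t : ℝ => (f ((t, w), s)).1.1 - t) (2 * Real.pi) := fun t => by
    simp only [hf.apply_add_two_pi]
    ring
  obtain ⟨u, hu, hut⟩ := hper.exists_mem_Ico₀ Real.two_pi_pos t
  change |(f ((t, w), s)).1.1 - t| ≤ C
  rw [hut]
  exact hC ((u, w), s) ⟨⟨⟨hu.1, hu.2.le⟩, trivial⟩, trivial⟩

/-- Transporting a point by one lift and back by the inverse of another lift moves the
`ℝ`-coordinate by a bounded amount. -/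
theorem IsPLift.exists_sub_le_inverse_comp {F₀ F₁ : V × II → V × II}
    {f₀ f₁ g₁ : (ℝ × S3) × II → (ℝ × S3) × II} (h₀ : IsPLift F₀ f₀) (h₁ : IsPLift F₁ f₁)
    (hg : Function.RightInverse g₁ f₁) : ∃ C : ℝ, ∀ q, q.1.1 - C ≤ (g₁ (f₀ q)).1.1 := by
  obtain ⟨C₀, hC₀⟩ := h₀.exists_abs_sub_le
  obtain ⟨C₁, hC₁⟩ := h₁.exists_abs_sub_le
  refine ⟨C₀ + C₁, fun q => ?_⟩
  have h := hC₁ (g₁ (f₀ q))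
  rw [hg] at h
  linarith [(abs_le.1 (hC₀ q)).1, (abs_le.1 h).2]

theorem IsDiffeoB.comp {E H M E' H' M' E'' H'' M'' : Type*}
    [NormedAddCommGroup E] [NormedSpace ℝ E] [TopologicalSpace H]
    [NormedAddCommGroup E'] [NormedSpace ℝ E'] [TopologicalSpace H']
    [NormedAddCommGroup E''] [NormedSpace ℝ E''] [TopologicalSpace H'']
    {I : ModelWithCorners ℝ E H} {I' : ModelWithCorners ℝ E' H'}
    {I'' : ModelWithCorners ℝ E'' H''}
    [TopologicalSpace M] [ChartedSpace H M] [TopologicalSpace M'] [ChartedSpace H' M']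
    [TopologicalSpace M''] [ChartedSpace H'' M''] {g : M' → M''} {f : M → M'}
    (hg : IsDiffeoB I' I'' g) (hf : IsDiffeoB I I' f) : IsDiffeoB I I'' (g ∘ f) := by
  obtain ⟨hg, g', hg', hgl, hgr⟩ := hg
  obtain ⟨hf, f', hf', hfl, hfr⟩ := hf
  exact ⟨hg.comp hf, f' ∘ g', hf'.comp hg', hgl.comp hfl, hgr.comp hfr⟩

theorem IsPseudoIsotopyFromId.psEquiv_refl {F : V × II → V × II}
    (hF : IsPseudoIsotopyFromId F) : PSEquiv F F := by
  obtain ⟨f, hf⟩ := hF.exists_isPLift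
  exact ⟨f, f, f, hf, hf, hf.1, 0, 0, le_rfl, fun _ _ => rfl, fun _ _ => rfl⟩

theorem PSEquiv.symm {F₀ F₁ : V × II → V × II} (h : PSEquiv F₀ F₁) : PSEquiv F₁ F₀ := by
  obtain ⟨f₀, f₁, H, h₀, h₁, ⟨hH, K, hK, hKH, hHK⟩, a, b, -, ha, hb⟩ := h
  obtain ⟨g₁, -, hgl, hgr⟩ := h₁.1.2
  obtain ⟨C, hC⟩ := h₀.exists_sub_le_inverse_comp h₁ hgr
  refine ⟨f₁, f₀, f₁ ∘ K ∘ f₀, h₁, h₀, h₁.1.comp (.comp ⟨hK, H, hH, hHK, hKH⟩ h₀.1), a,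
    max a (b + C), le_max_left _ _, fun q hq => ?_, fun q hq => ?_⟩
  · simp only [Function.comp_apply]
    rw [← ha q hq, hKH]
  · have hbq : b ≤ (g₁ (f₀ q)).1.1 := by linarith [hC q, le_of_max_le_right hq]
    have hH : H (g₁ (f₀ q)) = f₀ q := by rw [hb _ hbq, hgr]
    have hKq : K (f₀ q) = g₁ (f₀ q) := by rw [← hKH (g₁ (f₀ q)), hH]
    simp only [Function.comp_apply]
    rw [hKq, hgr]

theorem PSEquiv.trans {F₀ F₁ F₂ : V × II → V × II} (h : PSEquiv F₀ F₁) (h' : PSEquiv F₁ F₂) :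
    PSEquiv F₀ F₂ := by
  obtain ⟨f₀, f₁, H, h₀, h₁, hH, a, b, -, ha, hb⟩ := h
  obtain ⟨f₁', f₂, K, h₁', h₂, hK, a', b', -, ha', hb'⟩ := h'
  obtain rfl := h₁.unique h₁'
  obtain ⟨hf₁, g₁, hg₁, hgl, hgr⟩ := h₁.1
  obtain ⟨C, hC⟩ := h₂.exists_sub_le_inverse_comp h₁ hgr
  refine ⟨f₀, f₂, H ∘ g₁ ∘ K, h₀, h₂, hH.comp (.comp ⟨hg₁, f₁, hf₁, hgr, hgl⟩ hK), min a a',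
    max (min a a') (max b' (b + C)), le_max_left _ _, fun q hq => ?_, fun q hq => ?_⟩
  · simp only [Function.comp_apply]
    rw [ha' q (hq.trans (min_le_right _ _)), hgl, ha q (hq.trans (min_le_left _ _))]
  · have hq' := le_of_max_le_right hq
    simp only [Function.comp_apply]
    rw [hb' q (le_of_max_le_left hq'), hb _ (by linarith [hC q, le_of_max_le_right hq']), hgr]

/-- S-equivalence is an equivalence relation on pseudo-isotopies of `V` starting at the
identity. -/
theorem psequiv_is_equivalence :
    (∀ F : V × II → V × II, IsPseudoIsotopyFromId F → PSEquiv F F) ∧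
    (∀ F₀ F₁ : V × II → V × II, IsPseudoIsotopyFromId F₀ → IsPseudoIsotopyFromId F₁ →
      PSEquiv F₀ F₁ → PSEquiv F₁ F₀) ∧
    (∀ F₀ F₁ F₂ : V × II → V × II, IsPseudoIsotopyFromId F₀ → IsPseudoIsotopyFromId F₁ →
      IsPseudoIsotopyFromId F₂ → PSEquiv F₀ F₁ → PSEquiv F₁ F₂ → PSEquiv F₀ F₂) := by
  exact ⟨fun _ hF => hF.psEquiv_refl, fun _ _ _ _ h => h.symm, fun _ _ _ _ _ _ h h' => h.trans h'⟩

end
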